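/- arXiv:2403.06055 — 2 statements merged into one kernel-verified Lean document; each statement's English description precedes it below -/
import Mathlib

section
/- The evolution relations hold: D(Ū) = L·Ū - Ū·L* + Ū·O_L·Ū - U·O_L·V and D(V̄) = -L·V̄ + V̄·L* - V̄·O_L·V̄ + V·O_L·U. (Proposition 3.4 of the paper, derivatives of Ū and V̄.) -/
/-- A derivation kills `1`. -/
theorem leibniz_map_one {R : Type*} [Ring R] (D : R →+ R)
    (hD : ∀ x y, D (x * y) = D x * y + x * D y) : D 1 = 0 := by
  simpa using hD 1 1

/-- The derivative of a two-sided inverse. -/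
theorem leibniz_map_inverse {R : Type*} [Ring R] (D : R →+ R)
    (hD : ∀ x y, D (x * y) = D x * y + x * D y) {x y : R} (hxy : x * y = 1) (hyx : y * x = 1) :
    D y = -(y * D x * y) := by
  have h : D x * y + x * D y = 0 := by rw [← hD, hxy, leibniz_map_one D hD]
  calc D y = y * x * D y := by rw [hyx, one_mul]
    _ = y * (D x * y + x * D y) - y * D x * y := by noncomm_ring
    _ = -(y * D x * y) := by rw [h, mul_zero, zero_sub]

/-- A Woodbury-type identity for the inverse of `⅟E - W * C * W`. -/
theorem invOf_sub_mul_mul_eq {R : Type*} [Ring R] (W C E : R) [Invertible C] [Invertible E]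
    [Invertible (⅟C - W * E * W)] [Invertible (⅟E - W * C * W)] :
    ⅟(⅟E - W * C * W) = E + E * W * ⅟(⅟C - W * E * W) * W * E := by
  apply invOf_eq_right_inv
  set U := ⅟(⅟C - W * E * W)
  have hU : (⅟C - W * E * W) * U = 1 := mul_invOf_self _
  have hU' : U = C + C * W * E * W * U := by
    calc U = C * ((⅟C - W * E * W) * U) + C * W * E * W * U := by
          simp only [sub_mul, mul_sub, ← mul_assoc, mul_invOf_self, one_mul, sub_add_cancel]
      _ = C + C * W * E * W * U := by rw [hU, mul_one]
  calc (⅟E - W * C * W) * (E + E * W * U * W * E)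
      = ⅟E * E + ⅟E * E * W * U * W * E - W * (C + C * W * E * W * U) * W * E := by noncomm_ring
    _ = 1 := by rw [← hU', invOf_mul_self, one_mul, add_sub_cancel_right]

/-- Evolution of `-(⅟(⅟C - W * E * W) * W * E)` under a derivation acting on `C` and `E` by
opposite flows generated by `L` and `M`. -/
theorem leibniz_map_neg_invOf_mul {R : Type*} [Ring R] (D : R →+ R)
    (hD : ∀ x y, D (x * y) = D x * y + x * D y)
    (W C E L M : R) [Invertible C] [Invertible E]
    [Invertible (⅟C - W * E * W)] [Invertible (⅟E - W * C * W)]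
    (hW : D W = 0) (hC : D C = L * C + C * M) (hE : D E = -(L * E + E * M))
    {U V X : R} (hU : U = ⅟(⅟C - W * E * W)) (hV : V = ⅟(⅟E - W * C * W))
    (hX : X = -(U * W * E)) :
    D X = L * X - X * M + X * (M * W - W * L) * X - U * (M * W - W * L) * V := by
  have hA : D ⅟C = -(⅟C * L + M * ⅟C) := by
    rw [leibniz_map_inverse D hD (mul_invOf_self C) (invOf_mul_self C), hC, mul_add, add_mul,
      invOf_mul_cancel_left, ← mul_assoc, mul_invOf_cancel_right]
  have hl : U * ⅟C = 1 + U * W * E * W := by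
    have h : U * (⅟C - W * E * W) = 1 := by rw [hU, invOf_mul_self]
    rw [mul_sub, sub_eq_iff_eq_add] at h
    rw [h]
    noncomm_ring
  have hr : ⅟C * U = 1 + W * E * W * U := by
    have h : (⅟C - W * E * W) * U = 1 := by rw [hU, mul_invOf_self]
    rwa [sub_mul, sub_eq_iff_eq_add] at h
  have hDU : D U = L * U + U * M - U * W * E * (M * W - W * L) * U
      + U * (M * W - W * L) * E * W * U := by
    have h : D U = -(U * D (⅟C - W * E * W) * U) :=
      leibniz_map_inverse D hD (by rw [hU, mul_invOf_self]) (by rw [hU, invOf_mul_self])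
    calc D U = U * ⅟C * L * U + U * M * (⅟C * U) - U * W * (L * E + E * M) * W * U := by
          rw [h, map_sub, hA, hD, hD, hW, hE]
          noncomm_ring
      _ = _ := by
          rw [hl, hr]
          noncomm_ring
  have hV' : V = E + E * W * U * W * E := by rw [hV, hU, invOf_sub_mul_mul_eq]
  rw [hX, map_neg, hD, hD, hW, hE, hDU, hV']
  noncomm_ring


/-- Proposition 3.4: the evolution relations
`D(Ū) = L·Ū - Ū·L* + Ū·O_L·Ū - U·O_L·V` and
`D(V̄) = -L·V̄ + V̄·L* - V̄·O_L·V̄ + V·O_L·U`. -/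
theorem stmt_3 (R : Type*) [Ring R] [StarRing R]
    (Ω C₁ C₂ : R)
    (hΩ : star Ω = -Ω) (hC₁s : star C₁ = C₁) (hC₂s : star C₂ = C₂)
    [Invertible C₁] [Invertible C₂]
    [Invertible (⅟C₁ - Ω * C₂ * Ω)] [Invertible (⅟C₂ - Ω * C₁ * Ω)]
    (U V Ub Vb : R)
    (hU : U = ⅟(⅟C₁ - Ω * C₂ * Ω))
    (hV : V = ⅟(⅟C₂ - Ω * C₁ * Ω))
    (hUb : Ub = -(U * Ω * C₂))
    (hVb : Vb = -(V * Ω * C₁))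
    (L OL : R)
    (hL1 : L * C₁ = C₁ * star L) (hL2 : L * C₂ = C₂ * star L)
    (hOL : OL = star L * Ω - Ω * L)
    (D : R → R)
    (hDadd : ∀ x y, D (x + y) = D x + D y)
    (hDmul : ∀ x y, D (x * y) = D x * y + x * D y)
    (hDΩ : D Ω = 0) (hDL : D L = 0) (hDLs : D (star L) = 0)
    (hDC₁ : D C₁ = L * C₁ + C₁ * star L)
    (hDC₂ : D C₂ = -(L * C₂ + C₂ * star L)) :
    D Ub = L * Ub - Ub * star L + Ub * OL * Ub - U * OL * V ∧
    D Vb = -(L * Vb) + Vb * star L - Vb * OL * Vb + V * OL * U := by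
  let D' : R →+ R := AddMonoidHom.mk' D hDadd
  subst hOL
  refine ⟨leibniz_map_neg_invOf_mul D' hDmul Ω C₁ C₂ L (star L) hDΩ hDC₁ hDC₂ hU hV hUb, ?_⟩
  have h := leibniz_map_neg_invOf_mul D' hDmul Ω C₂ C₁ (-L) (-star L) hDΩ
    (by change D C₂ = _; rw [hDC₂]; noncomm_ring) (by change D C₁ = _; rw [hDC₁]; noncomm_ring)
    hV hU hVb
  refine h.trans ?_
  noncomm_ring
end

section
/- The differential recurrence relation of Theorem 3.1 holds: D'(𝕋)·((S*)⁻¹·I) + D(𝕋)·(O_S·I)·𝕋·((S*)⁻¹·I) = D(𝕋), where D and D' act entrywise on 2×2 matrices over R. -/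
theorem Matrix.map_mul_of_leibniz {ι R : Type*} [Fintype ι] [Ring R] (D : R → R)
    (hadd : ∀ x y, D (x + y) = D x + D y) (hmul : ∀ x y, D (x * y) = D x * y + x * D y)
    (A B : Matrix ι ι R) : (A * B).map D = A.map D * B + A * B.map D := by
  ext i j
  have hsum := map_sum (AddMonoidHom.mk' D hadd) (fun k => A i k * B k j) Finset.univ
  simp only [AddMonoidHom.mk'_apply] at hsum
  simp [Matrix.mul_apply, hsum, hmul, Finset.sum_add_distrib]

theorem leibniz_one {R : Type*} [Ring R] {D : R → R}
    (hmul : ∀ x y, D (x * y) = D x * y + x * D y) : D 1 = 0 := by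
  simpa using hmul 1 1

/-- A derivation with `D c = e • (l * c)` satisfies `D c⁻¹ = -e • (c⁻¹ * l)`. -/
theorem leibniz_invOf {R : Type*} [Ring R] {D : R → R}
    (hmul : ∀ x y, D (x * y) = D x * y + x * D y) {c l : R} [Invertible c] {e : ℤ}
    (hc : D c = e • (l * c)) : D (⅟c) = -e • (⅟c * l) := by
  have h := hmul (⅟c) c
  rw [invOf_mul_self, leibniz_one hmul, hc] at h
  have h2 : D (⅟c) * c = -(⅟c * e • (l * c)) := eq_neg_of_add_eq_zero_left h.symm
  calc D (⅟c) = D (⅟c) * c * ⅟c := by simp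
    _ = -e • (⅟c * l) := by rw [h2, mul_smul_comm, ← smul_neg, smul_mul_assoc, neg_mul]; simp [mul_assoc, -zsmul_eq_mul]

/-- The derivative of `t = n⁻¹` is `-t * D n * t`, for a derivation acting entrywise. -/
theorem Matrix.map_leibniz_of_mul_eq_one {ι R : Type*} [Fintype ι] [DecidableEq ι] [Ring R]
    {D : R → R} (hadd : ∀ x y, D (x + y) = D x + D y)
    (hmul : ∀ x y, D (x * y) = D x * y + x * D y)
    {t n : Matrix ι ι R} (htn : t * n = 1) (hnt : n * t = 1) :
    t.map D = -(t * n.map D * t) := by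
  have h0 : D 0 = 0 := by simpa using hadd 0 0
  have h := Matrix.map_mul_of_leibniz D hadd hmul t n
  have h1 : (1 : Matrix ι ι R).map D = 0 := by
    ext i j
    by_cases hij : i = j <;> simp [hij, h0, leibniz_one hmul]
  rw [htn, h1] at h
  have h2 : t.map D * n = -(t * n.map D) := eq_neg_of_add_eq_zero_left h.symm
  calc t.map D = t.map D * n * t := by rw [mul_assoc, hnt, mul_one]
    _ = _ := by rw [h2, neg_mul]

/-- The noncommutative-ring core of the recurrence: `t = n⁻¹`, `p = D n`, `p * s = D' n`. -/
theorem recurrence_of_intertwining {M : Type*} [Ring M] {t n p s s' o i : M}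
    (htn : t * n = 1) (hnt : n * t = 1) (hi : s' * i = 1) (ho : n * s + o = s' * n) :
    -(t * (p * s) * t) * i + -(t * p * t) * o * t * i = -(t * p * t) := by
  have key : s * t + t * o * t = t * s' := by
    calc s * t + t * o * t = t * n * s * t + t * o * t := by rw [htn, one_mul]
      _ = t * (n * s + o) * t := by noncomm_ring
      _ = t * s' * (n * t) := by rw [ho]; noncomm_ring
      _ = t * s' := by rw [hnt, mul_one]
  calc _ = -(t * p * (s * t + t * o * t) * i) := by noncomm_ring
    _ = -(t * p * t * (s' * i)) := by rw [key]; noncomm_ring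
    _ = _ := by rw [hi, mul_one]

theorem invOf_mul_comm_of_intertwining {R : Type*} [Ring R] {c a b : R} [Invertible c]
    (h : a * c = c * b) : ⅟c * a = b * ⅟c := by
  calc ⅟c * a = ⅟c * (a * c) * ⅟c := by simp [mul_assoc]
    _ = b * ⅟c := by rw [h]; simp

/-- Theorem 3.1: the differential recurrence relation
`D'(𝕋)·((S*)⁻¹·I) + D(𝕋)·(O_S·I)·𝕋·((S*)⁻¹·I) = D(𝕋)`,
where `D`, `D'` act entrywise on 2×2 matrices over `R`. -/
theorem stmt_7 (R : Type*) [Ring R] [StarRing R]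
    (Ω C₁ C₂ : R)
    (hΩ : star Ω = -Ω) (hC₁s : star C₁ = C₁) (hC₂s : star C₂ = C₂)
    [Invertible C₁] [Invertible C₂]
    [Invertible (⅟C₁ - Ω * C₂ * Ω)] [Invertible (⅟C₂ - Ω * C₁ * Ω)]
    (U V Ub Vb : R)
    (hU : U = ⅟(⅟C₁ - Ω * C₂ * Ω))
    (hV : V = ⅟(⅟C₂ - Ω * C₁ * Ω))
    (hUb : Ub = -(U * Ω * C₂))
    (hVb : Vb = -(V * Ω * C₁))
    (L S OS : R)
    (hLS : L * S = S * L)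
    (hL1 : L * C₁ = C₁ * star L) (hL2 : L * C₂ = C₂ * star L)
    (hS1 : S * C₁ = C₁ * star S) (hS2 : S * C₂ = C₂ * star S)
    [Invertible S] [Invertible (star S)]
    (hOS : OS = star S * Ω - Ω * S)
    (D D' : R → R)
    (hDadd : ∀ x y, D (x + y) = D x + D y)
    (hDmul : ∀ x y, D (x * y) = D x * y + x * D y)
    (hD'add : ∀ x y, D' (x + y) = D' x + D' y)
    (hD'mul : ∀ x y, D' (x * y) = D' x * y + x * D' y)
    (hDΩ : D Ω = 0) (hDL : D L = 0) (hDLs : D (star L) = 0)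
    (hDS : D S = 0) (hDSs : D (star S) = 0)
    (hD'Ω : D' Ω = 0) (hD'L : D' L = 0) (hD'Ls : D' (star L) = 0)
    (hD'S : D' S = 0) (hD'Ss : D' (star S) = 0)
    (hDC₁ : D C₁ = L * C₁ + C₁ * star L)
    (hDC₂ : D C₂ = -(L * C₂ + C₂ * star L))
    (hD'C₁ : D' C₁ = (L * S) * C₁ + C₁ * star (L * S))
    (hD'C₂ : D' C₂ = -((L * S) * C₂ + C₂ * star (L * S)))
    (T : Matrix (Fin 2) (Fin 2) R)
    (hT : T = !![Vb, V; U, Ub]) :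
    T.map D' * !![⅟(star S), 0; 0, ⅟(star S)]
      + T.map D * !![OS, 0; 0, OS] * T * !![⅟(star S), 0; 0, ⅟(star S)]
      = T.map D := by
  set N : Matrix (Fin 2) (Fin 2) R := !![Ω, ⅟C₁; ⅟C₂, Ω] with hN
  have hUl : U * ⅟C₁ - U * Ω * C₂ * Ω = 1 := by
    have h := invOf_mul_self (⅟C₁ - Ω * C₂ * Ω)
    rwa [← hU, mul_sub, ← mul_assoc, ← mul_assoc] at h
  have hVl : V * ⅟C₂ - V * Ω * C₁ * Ω = 1 := by
    have h := invOf_mul_self (⅟C₂ - Ω * C₁ * Ω)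
    rwa [← hV, mul_sub, ← mul_assoc, ← mul_assoc] at h
  have hUr : ⅟C₁ * U - Ω * C₂ * Ω * U = 1 := by
    have h := mul_invOf_self (⅟C₁ - Ω * C₂ * Ω)
    rwa [← hU, sub_mul] at h
  have hVr : ⅟C₂ * V - Ω * C₁ * Ω * V = 1 := by
    have h := mul_invOf_self (⅟C₂ - Ω * C₁ * Ω)
    rwa [← hV, sub_mul] at h
  have hTN : T * N = 1 := by
    rw [hT, hN, hUb, hVb, Matrix.mul_fin_two, Matrix.one_fin_two]
    simp [mul_assoc] at hUl hVl ⊢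
    constructor
    · rw [← hVl]; abel
    · rw [← hUl]; abel
  have hNT' : N * !![-(C₂ * Ω * U), V; U, -(C₁ * Ω * V)] = 1 := by
    rw [hN, Matrix.mul_fin_two, Matrix.one_fin_two]
    simp [mul_assoc] at hUr hVr ⊢
    constructor
    · rw [← hUr]; abel
    · rw [← hVr]; abel
  have hNT : N * T = 1 := by rwa [left_inv_eq_right_inv hTN hNT']
  have hLS₁ : C₁ * star (L * S) = L * S * C₁ := by
    rw [star_mul, ← mul_assoc, ← hS1, mul_assoc, ← hL1, ← mul_assoc, hLS]
  have hLS₂ : C₂ * star (L * S) = L * S * C₂ := by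
    rw [star_mul, ← mul_assoc, ← hS2, mul_assoc, ← hL2, ← mul_assoc, hLS]
  have hND : N.map D = !![0, -2 • (⅟C₁ * L); 2 • (⅟C₂ * L), 0] := by
    have h₁ := leibniz_invOf hDmul (c := C₁) (l := L) (e := 2) (by
      rw [hDC₁, ← hL1, two_zsmul])
    have h₂ := leibniz_invOf hDmul (c := C₂) (l := L) (e := -2) (by
      rw [hDC₂, ← hL2, neg_zsmul, two_zsmul])
    ext i j
    fin_cases i <;> fin_cases j <;> simp [hN, hDΩ, h₁, h₂, two_mul]
  have hND' : N.map D' =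
      !![0, -2 • (⅟C₁ * L); 2 • (⅟C₂ * L), 0] * !![S, 0; 0, S] := by
    have h₁ := leibniz_invOf hD'mul (c := C₁) (l := L * S) (e := 2) (by
      rw [hD'C₁, hLS₁, two_zsmul])
    have h₂ := leibniz_invOf hD'mul (c := C₂) (l := L * S) (e := -2) (by
      rw [hD'C₂, hLS₂, neg_zsmul, two_zsmul])
    ext i j
    fin_cases i <;> fin_cases j <;> simp [hN, hD'Ω, h₁, h₂, mul_assoc]
  rw [Matrix.map_leibniz_of_mul_eq_one hDadd hDmul hTN hNT,
    Matrix.map_leibniz_of_mul_eq_one hD'add hD'mul hTN hNT, hND', hND]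
  refine recurrence_of_intertwining (s' := !![star S, 0; 0, star S]) hTN hNT ?_ ?_
  · simp [Matrix.one_fin_two]
  · have h₁ := invOf_mul_comm_of_intertwining hS1
    have h₂ := invOf_mul_comm_of_intertwining hS2
    simp [hN, hOS, h₁, h₂]
end
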